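/- Let A be an irreducible n×n matrix with entries in {0,1}, let X_A be the associated shift of finite type over the alphabet 𝒜 = {0,…,n−1}, and let θ = θ_{G_A} be the cycle-substitution associated with the graph G_A of A. Then θ is a primitive random substitution and X_θ = X_A. -/

import Mathlib

namespace RS

variable {A : Type*} {V : Type*}

/-- The set of realisations of a random substitution applied (once) to a word. -/
def real (θ : A → Set (List A)) : List A → Set (List A)
  | [] => {[]}
  | a :: w => {u | ∃ v ∈ θ a, ∃ r ∈ real θ w, u = v ++ r}

/-- The set of realisations of the `k`-th power of a random substitution on a word. -/
def realPow (θ : A → Set (List A)) : ℕ → List A → Set (List A)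
  | 0, w => {w}
  | k + 1, w => ⋃ v ∈ real θ w, realPow θ k v

/-- `θ` is a random substitution: each letter has a nonempty finite set of
nonempty realisations. -/
def IsRandomSubst (θ : A → Set (List A)) : Prop :=
  ∀ a, (θ a).Nonempty ∧ (θ a).Finite ∧ ∀ u ∈ θ a, u ≠ []

/-- Primitivity of a random substitution. -/
def Primitive (θ : A → Set (List A)) : Prop :=
  ∃ k : ℕ, ∀ a b : A, ∃ v ∈ realPow θ k [b], a ∈ v

/-- `θ`-legal words. -/
def Legal (θ : A → Set (List A)) (u : List A) : Prop :=
  ∃ (k : ℕ) (a : A) (v : List A), v ∈ realPow θ k [a] ∧ u <:+: v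

/-- The subword of a bi-infinite sequence starting at `i` of length `n`. -/
def subwordAt (x : ℤ → A) (i : ℤ) (n : ℕ) : List A :=
  List.ofFn fun j : Fin n => x (i + (j : ℤ))

/-- The RS-subshift of a random substitution. -/
def X (θ : A → Set (List A)) : Set (ℤ → A) :=
  {x | ∀ (i : ℤ) (n : ℕ), Legal θ (subwordAt x i n)}

/-- The left shift on bi-infinite sequences. -/
def shift (x : ℤ → A) : ℤ → A := fun i => x (i + 1)

/-- The words of length `n` in the language of a subshift. -/
def lang (Y : Set (ℤ → A)) (n : ℕ) : Set (List A) :=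
  {u | u.length = n ∧ ∃ x ∈ Y, ∃ i : ℤ, u = subwordAt x i n}

/-- Topological entropy of a subshift. -/
noncomputable def entropy (Y : Set (ℤ → A)) : ℝ :=
  Filter.limsup (fun n : ℕ => Real.log ((lang Y n).ncard) / n) Filter.atTop

/-- Source of a list of edges. -/
def src (γ : List (V × V)) : Option V := γ.head?.map Prod.fst

/-- Target of a list of edges. -/
def tgt (γ : List (V × V)) : Option V := γ.getLast?.map Prod.snd

/-- A (nonempty) path in the directed graph with edge set `E`. -/
def IsPath (E : Set (V × V)) (γ : List (V × V)) : Prop :=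
  γ ≠ [] ∧ (∀ e ∈ γ, e ∈ E) ∧ γ.Chain' fun e f => e.2 = f.1

/-- A cycle: a path whose source equals its target. -/
def IsCycle (E : Set (V × V)) (γ : List (V × V)) : Prop :=
  IsPath E γ ∧ src γ = tgt γ

/-- A simple path/cycle: the sources of its edges are pairwise distinct. -/
def IsSimple (γ : List (V × V)) : Prop := (γ.map Prod.fst).Nodup

/-- Strong connectivity. -/
def StronglyConnected (E : Set (V × V)) : Prop :=
  ∀ v w : V, ∃ γ : List (V × V), IsPath E γ ∧ src γ = some v ∧ tgt γ = some w

/-- The word read of a cycle: the sources of its edges followed by its root. -/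
def wordRead (γ : List (V × V)) : List V :=
  γ.map Prod.fst ++ (src γ).toList

/-- The cycle-substitution associated with the graph on the alphabet `A`
with edge set `E`. -/
def cycleSubst (E : Set (A × A)) (a : A) : Set (List A) :=
  {[a]} ∪ {u | ∃ γ : List (A × A), IsCycle E γ ∧ IsSimple γ ∧ src γ = some a ∧ u = wordRead γ}

/-- The word `w` applied under a deterministic substitution `φ`. -/
def detApply (φ : A → List A) (w : List A) : List A := (w.map φ).flatten

/-- Primitivity of a deterministic substitution. -/
def DetPrimitive (φ : A → List A) : Prop :=
  ∃ k : ℕ, ∀ a b : A, b ∈ (detApply φ)^[k] [a]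

/-- The subshift of a deterministic substitution. -/
def Xdet (φ : A → List A) : Set (ℤ → A) :=
  {x | ∀ (i : ℤ) (n : ℕ), ∃ (k : ℕ) (a : A), subwordAt x i n <:+: (detApply φ)^[k] [a]}

/-- Substitutive subshifts. -/
def Substitutive (Y : Set (ℤ → A)) : Prop :=
  ∃ φ : A → List A, (∀ a, φ a ≠ []) ∧ DetPrimitive φ ∧ Y = Xdet φ

/-- A factor map between subshifts. -/
def IsFactorMap {A B : Type*} [TopologicalSpace A] [TopologicalSpace B]
    (Y : Set (ℤ → A)) (Z : Set (ℤ → B)) (f : Y → Z) : Prop :=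
  Continuous f ∧ Function.Surjective f ∧
    ∀ (x : ℤ → A) (hx : x ∈ Y) (hx' : shift x ∈ Y),
      ((f ⟨shift x, hx'⟩ : Z) : ℤ → B) = shift ((f ⟨x, hx⟩ : Z) : ℤ → B)

end RS

namespace RS

section Realisations

variable {A : Type*} {θ : A → Set (List A)}

lemma real_append : ∀ {w w' u u' : List A}, u ∈ real θ w → u' ∈ real θ w' →
    u ++ u' ∈ real θ (w ++ w')
  | [], _, u, _, hu, hu' => by
    obtain rfl : u = [] := hu
    exact hu'
  | _ :: w, _, _, _, ⟨v, hv, r, hr, hu⟩, hu' => by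
    subst hu
    exact ⟨v, hv, _, real_append hr hu', List.append_assoc _ _ _⟩

lemma self_mem_real (hθ : ∀ a, [a] ∈ θ a) : ∀ w : List A, w ∈ real θ w
  | [] => rfl
  | a :: w => ⟨[a], hθ a, w, self_mem_real hθ w, rfl⟩

lemma mem_realPow_succ {k : ℕ} {w u : List A} :
    u ∈ realPow θ (k + 1) w ↔ ∃ v ∈ real θ w, u ∈ realPow θ k v := by
  simp [realPow]

lemma realPow_append : ∀ {k : ℕ} {w w' u u' : List A}, u ∈ realPow θ k w →
    u' ∈ realPow θ k w' → u ++ u' ∈ realPow θ k (w ++ w')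
  | 0, w, w', u, u', hu, hu' => by
    obtain rfl : u = w := hu
    obtain rfl : u' = w' := hu'
    rfl
  | k + 1, _, _, _, _, hu, hu' => by
    obtain ⟨v, hv, hu⟩ := mem_realPow_succ.1 hu
    obtain ⟨v', hv', hu'⟩ := mem_realPow_succ.1 hu'
    exact mem_realPow_succ.2 ⟨_, real_append hv hv', realPow_append hu hu'⟩

lemma self_mem_realPow (hθ : ∀ a, [a] ∈ θ a) : ∀ (k : ℕ) (w : List A), w ∈ realPow θ k w
  | 0, _ => rfl
  | k + 1, w => mem_realPow_succ.2 ⟨w, self_mem_real hθ w, self_mem_realPow hθ k w⟩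

lemma realPow_trans : ∀ {j k : ℕ} {w v u : List A}, v ∈ realPow θ j w →
    u ∈ realPow θ k v → u ∈ realPow θ (j + k) w
  | 0, k, w, v, u, hv, hu => by
    obtain rfl : v = w := hv
    rwa [Nat.zero_add]
  | j + 1, k, _, _, _, hv, hu => by
    obtain ⟨x, hx, hv⟩ := mem_realPow_succ.1 hv
    rw [Nat.add_right_comm]
    exact mem_realPow_succ.2 ⟨x, hx, realPow_trans hv hu⟩

lemma realPow_mono (hθ : ∀ a, [a] ∈ θ a) {j k : ℕ} (h : j ≤ k) {w u : List A}
    (hu : u ∈ realPow θ j w) : u ∈ realPow θ k w := by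
  obtain ⟨i, rfl⟩ := Nat.exists_eq_add_of_le h
  exact realPow_trans hu (self_mem_realPow hθ i u)

end Realisations

section Walks

variable {A : Type*} {E : Set (A × A)}

/-- `w` is the list of vertices visited by a (possibly trivial) walk from `a` to `b`. -/
def IsWalk (E : Set (A × A)) (a b : A) (w : List A) : Prop :=
  w.IsChain (fun x y => (x, y) ∈ E) ∧ w.head? = some a ∧ w.getLast? = some b

lemma IsPath.isWalk : ∀ {γ : List (A × A)} {a b : A}, IsPath E γ → src γ = some a →
    tgt γ = some b → IsWalk E a b (γ.map Prod.fst ++ [b])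
  | [], _, _, hγ, _, _ => absurd rfl hγ.1
  | [e], a, b, hγ, ha, hb => by
    have he : e ∈ E := hγ.2.1 e (by simp)
    simp only [src, tgt, List.head?_cons, List.getLast?_singleton, Option.map_some,
      Option.some.injEq] at ha hb
    subst ha hb
    simpa [IsWalk] using he
  | e :: f :: γ, a, b, ⟨_, hE, hc⟩, ha, hb => by
    have hc' := List.isChain_cons_cons.1 hc
    have he : e ∈ E := hE e (by simp)
    have ih := IsPath.isWalk (γ := f :: γ) (a := f.1) (b := b)
      ⟨by simp, fun x hx => hE x (List.mem_cons_of_mem _ hx), hc'.2⟩ rfl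
      (by simpa [tgt] using hb)
    have ha : e.1 = a := by simpa [src] using ha
    refine ⟨?_, by simpa using ha, List.getLast?_concat⟩
    have h1 := ih.1
    simp only [List.map_cons, List.cons_append, List.isChain_cons_cons] at h1 ⊢
    refine ⟨?_, h1⟩
    rw [← hc'.1]
    exact he

lemma exists_isPath : ∀ {l : List A} {a b : A},
    (a :: (l ++ [b])).IsChain (fun x y => (x, y) ∈ E) →
    ∃ γ, IsPath E γ ∧ γ.map Prod.fst = a :: l ∧ src γ = some a ∧ tgt γ = some b
  | [], a, b, h => by
    refine ⟨[(a, b)], ⟨by simp, ?_, List.isChain_singleton _⟩, rfl, rfl, rfl⟩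
    simpa using h
  | c :: l, a, b, h => by
    simp only [List.cons_append, List.isChain_cons_cons] at h
    obtain ⟨γ, ⟨hne, hE, hc⟩, hm, hs, ht⟩ := exists_isPath h.2
    refine ⟨(a, c) :: γ, ⟨by simp, ?_, ?_⟩, by simp [hm], rfl, ?_⟩
    · simpa [h.1] using hE
    · refine List.IsChain.cons hc fun y hy => ?_
      obtain ⟨z, hz, rfl⟩ := Option.map_eq_some_iff.1 hs
      rw [hz] at hy
      cases hy
      rfl
    · cases γ with
      | nil => exact absurd rfl hne
      | cons e γ => simpa [tgt] using ht

lemma singleton_mem_cycleSubst (a : A) : [a] ∈ cycleSubst E a := Or.inl rfl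

lemma isWalk_of_mem_cycleSubst {a : A} {u : List A} (hu : u ∈ cycleSubst E a) :
    IsWalk E a a u := by
  rcases hu with rfl | ⟨γ, ⟨hγ, hst⟩, -, hs, rfl⟩
  · simp [IsWalk]
  · simpa [wordRead, hs] using hγ.isWalk hs (hst ▸ hs)

lemma mem_cycleSubst_of_nodup {a : A} {l : List A} (hl : (a :: l).Nodup)
    (h : (a :: (l ++ [a])).IsChain (fun x y => (x, y) ∈ E)) :
    a :: (l ++ [a]) ∈ cycleSubst E a := by
  obtain ⟨γ, hγ, hm, hs, ht⟩ := exists_isPath h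
  refine Or.inr ⟨γ, ⟨hγ, hs.trans ht.symm⟩, ?_, hs, ?_⟩
  · rwa [IsSimple, hm]
  · simp [wordRead, hm, hs]

lemma isRandomSubst_cycleSubst [Finite A] : IsRandomSubst (cycleSubst E) := by
  cases nonempty_fintype A
  refine fun a => ⟨⟨_, singleton_mem_cycleSubst a⟩, ?_, ?_⟩
  · refine (List.finite_length_le A (Fintype.card A + 1)).subset ?_
    rintro u (rfl | ⟨γ, -, hγ, hs, rfl⟩)
    · simp
    · have := List.Nodup.length_le_card hγ
      simpa [wordRead, hs] using this
  · rintro u hu rfl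
    simpa using (isWalk_of_mem_cycleSubst hu).2.1

lemma isChain_of_mem_real {w u : List A} (hu : u ∈ real (cycleSubst E) w)
    (hw : w.IsChain (fun x y => (x, y) ∈ E)) :
    u.IsChain (fun x y => (x, y) ∈ E) ∧ u.head? = w.head? := by
  induction w generalizing u with
  | nil =>
    obtain rfl : u = [] := hu
    simp
  | cons a w ih =>
    obtain ⟨v, hv, r, hr, rfl⟩ := hu
    obtain ⟨hvc, hvh, hvl⟩ := isWalk_of_mem_cycleSubst hv
    obtain ⟨hrc, hrh⟩ := ih hr hw.tail
    refine ⟨List.isChain_append.2 ⟨hvc, hrc, ?_⟩, by simp [hvh]⟩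
    rw [hvl, hrh]
    rintro x hx y hy
    cases hx
    exact (List.isChain_cons.1 hw).1 y hy

lemma isChain_of_mem_realPow {k : ℕ} {w u : List A} (hu : u ∈ realPow (cycleSubst E) k w)
    (hw : w.IsChain (fun x y => (x, y) ∈ E)) : u.IsChain (fun x y => (x, y) ∈ E) := by
  induction k generalizing w with
  | zero =>
    obtain rfl : u = w := hu
    exact hw
  | succ k ih =>
    obtain ⟨v, hv, hu⟩ := mem_realPow_succ.1 hu
    exact ih hu (isChain_of_mem_real hv hw).1

lemma exists_eq_append_of_not_nodup : ∀ {l : List A}, ¬ l.Nodup →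
    ∃ p b q r, l = p ++ b :: (q ++ b :: r)
  | [], h => absurd List.nodup_nil h
  | x :: l, h => by
    by_cases hx : x ∈ l
    · obtain ⟨q, r, rfl⟩ := List.append_of_mem hx
      exact ⟨[], x, q, r, rfl⟩
    · obtain ⟨p, b, q, r, rfl⟩ :=
        exists_eq_append_of_not_nodup fun hl => h (List.nodup_cons.2 ⟨hx, hl⟩)
      exact ⟨x :: p, b, q, r, rfl⟩

/-- Every closed walk is obtained from its root by repeatedly inserting simple cycles. -/
lemma IsWalk.exists_mem_realPow {a : A} {w : List A} (hw : IsWalk E a a w) :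
    ∃ k, w ∈ realPow (cycleSubst E) k [a] := by
  obtain ⟨m, hm⟩ : ∃ m, w.length = m := ⟨_, rfl⟩
  induction m using Nat.strong_induction_on generalizing a w with
  | _ m ih =>
  obtain ⟨hc, hh, hl⟩ := hw
  obtain ⟨l, rfl⟩ := List.head?_eq_some_iff.1 hh
  rcases List.eq_nil_or_concat l with rfl | ⟨l, c, rfl⟩
  · exact ⟨0, rfl⟩
  obtain rfl : c = a := by
    rw [List.concat_eq_append, ← List.cons_append, List.getLast?_concat] at hl
    simpa using hl
  rw [List.concat_eq_append] at hc hm ⊢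
  by_cases hnd : (c :: l).Nodup
  · exact ⟨1, mem_realPow_succ.2
      ⟨_, ⟨_, mem_cycleSubst_of_nodup hnd hc, [], rfl, (List.append_nil _).symm⟩, rfl⟩⟩
  obtain ⟨p, b, q, r, hpq⟩ := exists_eq_append_of_not_nodup hnd
  have hw : c :: (l ++ [c]) = p ++ (b :: (q ++ [b]) ++ (r ++ [c])) := by
    rw [← List.cons_append, hpq]
    simp
  have hlen := congrArg List.length hw
  simp only [List.length_append, List.length_cons, List.length_nil] at hlen hm
  have hin : (b :: (q ++ [b])).IsChain (fun x y => (x, y) ∈ E) :=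
    hc.infix ⟨p, r ++ [c], by rw [hw, List.append_assoc]⟩
  have hpb : (p ++ [b]).IsChain (fun x y => (x, y) ∈ E) :=
    hc.infix ⟨[], q ++ b :: (r ++ [c]), by simp [hw]⟩
  have hbr : (b :: (r ++ [c])).IsChain (fun x y => (x, y) ∈ E) :=
    hc.infix ⟨p ++ b :: q, [], by simp [hw]⟩
  have hout : IsWalk E c c (p ++ ([b] ++ (r ++ [c]))) := by
    refine ⟨?_, ?_, by rw [← List.append_assoc, ← List.append_assoc, List.getLast?_concat]⟩
    · exact List.isChain_split.2 ⟨hpb, hbr⟩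
    · have := congrArg List.head? hpq
      cases p <;> simpa using this.symm
  obtain ⟨j, hj⟩ := ih _ (by simp; omega) hout rfl
  obtain ⟨k, hk⟩ := ih _ (by simp; omega) (a := b) (w := b :: (q ++ [b]))
    ⟨hin, rfl, by rw [← List.cons_append, List.getLast?_concat]⟩ rfl
  refine ⟨j + k, realPow_trans hj ?_⟩
  rw [hw]
  have hs := self_mem_realPow (singleton_mem_cycleSubst (E := E)) k
  exact realPow_append (hs p) (realPow_append hk (hs _))

lemma IsWalk.append {a b c : A} {w l : List A} (h : IsWalk E a b w)
    (h' : IsWalk E b c (b :: l)) : IsWalk E a c (w ++ l) := by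
  obtain ⟨v, rfl⟩ := List.getLast?_eq_some_iff.1 h.2.2
  refine ⟨?_, by simpa using h.2.1, ?_⟩
  · rw [List.append_assoc]
    exact List.isChain_split.2 ⟨h.1, h'.1⟩
  · rw [List.append_assoc, List.singleton_append, List.getLast?_append, h'.2.2]
    rfl

lemma exists_isWalk {a b : A} (h : Relation.ReflTransGen (fun x y => (x, y) ∈ E) a b) :
    ∃ l, IsWalk E a b (a :: l) := by
  obtain ⟨l, hl, hb⟩ := List.exists_isChain_cons_of_relationReflTransGen h
  exact ⟨l, hl, rfl, by rw [List.getLast?_eq_some_getLast (List.cons_ne_nil _ _), hb]⟩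

/-- In a strongly connected graph every walk is an initial segment of a word obtained from
its first vertex. -/
lemma IsWalk.exists_append_mem_realPow
    (hE : ∀ a b, Relation.ReflTransGen (fun x y => (x, y) ∈ E) a b) {a b : A} {w : List A}
    (hw : IsWalk E a b w) : ∃ k l, w ++ l ∈ realPow (cycleSubst E) k [a] := by
  obtain ⟨l, hl⟩ := exists_isWalk (hE b a)
  obtain ⟨k, hk⟩ := (hw.append hl).exists_mem_realPow
  exact ⟨k, l, hk⟩

lemma primitive_cycleSubst [Finite A]
    (hE : ∀ a b, Relation.ReflTransGen (fun x y => (x, y) ∈ E) a b) :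
    Primitive (cycleSubst E) := by
  have key : ∀ p : A × A, ∃ k, ∃ v ∈ realPow (cycleSubst E) k [p.2], p.1 ∈ v := by
    rintro ⟨a, b⟩
    obtain ⟨l, hl⟩ := exists_isWalk (hE b a)
    obtain ⟨k, l', hk⟩ := hl.exists_append_mem_realPow hE
    exact ⟨k, _, hk, List.mem_append_left _ (List.mem_of_getLast? hl.2.2)⟩
  choose f hf using key
  obtain ⟨K, hK⟩ := (Set.finite_range f).bddAbove
  refine ⟨K, fun a b => ?_⟩
  obtain ⟨v, hv, ha⟩ := hf (a, b)
  exact ⟨v, realPow_mono singleton_mem_cycleSubst (hK ⟨_, rfl⟩) hv, ha⟩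

lemma isChain_subwordAt_iff {x : ℤ → A} {i : ℤ} {n : ℕ} :
    (subwordAt x i n).IsChain (fun x y => (x, y) ∈ E) ↔
      ∀ j : ℕ, j + 1 < n → (x (i + j), x (i + j + 1)) ∈ E := by
  simp [subwordAt, List.isChain_iff_getElem, add_assoc]

lemma X_cycleSubst (hE : ∀ a b, Relation.ReflTransGen (fun x y => (x, y) ∈ E) a b) :
    X (cycleSubst E) = {x : ℤ → A | ∀ i : ℤ, (x i, x (i + 1)) ∈ E} := by
  ext x
  refine ⟨fun hx i => ?_, fun hx i n => ?_⟩
  · obtain ⟨k, a, v, hv, hs⟩ := hx i 2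
    have hc := (isChain_of_mem_realPow hv (List.isChain_singleton a)).infix hs
    simpa using isChain_subwordAt_iff.1 hc 0 (by norm_num)
  · have hc : (subwordAt x i n).IsChain (fun x y => (x, y) ∈ E) :=
      isChain_subwordAt_iff.2 fun j _ => hx _
    rcases hw : subwordAt x i n with _ | ⟨a, w⟩
    · exact ⟨0, x i, [x i], rfl, List.nil_infix⟩
    · rw [hw] at hc
      obtain ⟨k, l, hk⟩ := IsWalk.exists_append_mem_realPow hE
        ⟨hc, rfl, List.getLast?_eq_some_getLast (List.cons_ne_nil a w)⟩
      exact ⟨k, a, _, hk, (List.prefix_append _ _).isInfix⟩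

end Walks

lemma reflTransGen_of_pow_pos {ι : Type*} [Fintype ι] [DecidableEq ι] {M : Matrix ι ι ℕ}
    (h01 : ∀ i j, M i j = 0 ∨ M i j = 1) {k : ℕ} {i j : ι} (h : 1 ≤ (M ^ k) i j) :
    Relation.ReflTransGen (fun x y => (x, y) ∈ {p : ι × ι | M p.1 p.2 = 1}) i j := by
  induction k generalizing j with
  | zero =>
    by_cases hij : i = j
    · rw [hij]
    · simp [hij] at h
  | succ k ih =>
    rw [pow_succ, Matrix.mul_apply] at h
    obtain ⟨m, -, hm⟩ := Finset.exists_ne_zero_of_sum_ne_zero (Nat.one_le_iff_ne_zero.1 h)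
    have hm' := mul_ne_zero_iff.1 hm
    exact (ih (Nat.one_le_iff_ne_zero.2 hm'.1)).tail ((h01 m j).resolve_left hm'.2)

end RS

/-- For an irreducible `n × n` matrix `M` with entries in `{0,1}`, the
cycle-substitution of the graph of `M` is a primitive random substitution whose RS-subshift
equals the shift of finite type defined by `M`. -/
theorem stmt9 {n : ℕ} (M : Matrix (Fin n) (Fin n) ℕ)
    (h01 : ∀ i j, M i j = 0 ∨ M i j = 1)
    (hirr : ∀ i j, ∃ k : ℕ, 1 ≤ k ∧ 1 ≤ (M ^ k) i j) :
    RS.IsRandomSubst (RS.cycleSubst {p : Fin n × Fin n | M p.1 p.2 = 1}) ∧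
      RS.Primitive (RS.cycleSubst {p : Fin n × Fin n | M p.1 p.2 = 1}) ∧
      RS.X (RS.cycleSubst {p : Fin n × Fin n | M p.1 p.2 = 1}) =
        {x : ℤ → Fin n | ∀ i : ℤ, M (x i) (x (i + 1)) = 1} := by
  have hE := fun i j =>
    (hirr i j).elim fun _ hk => RS.reflTransGen_of_pow_pos h01 hk.2
  exact ⟨RS.isRandomSubst_cycleSubst, RS.primitive_cycleSubst hE, RS.X_cycleSubst hE⟩
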